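/- Let c = (3/2)^{2/3} and let V : (0,∞) → ℝ be continuous with |V(ξ)| ≤ K/(1+ξ) for all ξ > 0 and some K ≥ 0. Let E₁ ≠ E₂ be real numbers and for i = 1,2 let θ_i be differentiable on (1,∞) satisfying the Prüfer angle equation θ_i'(ξ) = 1 - Q(ξ,E_i)·sin²(θ_i(ξ)) for all ξ > 1, where Q(ξ,F) = -5/(36ξ²) - F/(c·ξ^{2/3}) + V(ξ). Then there exists a constant C > 0 such that for all ξ > ξ₀ > 1: |∫_{ξ₀}^{ξ} sin(2θ₁(x))·sin(2θ₂(x))/(1+x) dx| ≤ C·ξ₀^{-1/3}. -/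

import Mathlib

open Filter Real intervalIntegral

/-- The transformed potential `Q(ξ,F) = -5/(36ξ²) - F/(c·ξ^{2/3}) + V(ξ)` with
`c = (3/2)^{2/3}`. -/
noncomputable def Qpot (V : ℝ → ℝ) (F ξ : ℝ) : ℝ :=
  -5 / (36 * ξ ^ 2) - F / (((3 : ℝ) / 2) ^ ((2 : ℝ) / 3) * ξ ^ ((2 : ℝ) / 3)) + V ξ

def Ob (f : ℝ → ℝ) (s : ℝ) : Prop := ∃ C : ℝ, 0 ≤ C ∧ ∀ x : ℝ, 1 < x → |f x| ≤ C * x ^ s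

lemma Ob.mono {f : ℝ → ℝ} {s t : ℝ} (h : Ob f s) (hst : s ≤ t) : Ob f t := by
  obtain ⟨C, hC, h⟩ := h
  refine ⟨C, hC, fun x hx => (h x hx).trans ?_⟩
  exact mul_le_mul_of_nonneg_left (Real.rpow_le_rpow_of_exponent_le hx.le hst) hC

lemma Ob.add {f g : ℝ → ℝ} {s : ℝ} (hf : Ob f s) (hg : Ob g s) : Ob (fun x => f x + g x) s := by
  obtain ⟨C, hC, hf⟩ := hf
  obtain ⟨D, hD, hg⟩ := hg
  refine ⟨C + D, by positivity, fun x hx => (abs_add_le _ _).trans ?_⟩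
  linarith [hf x hx, hg x hx, add_mul C D (x ^ s)]

lemma Ob.neg {f : ℝ → ℝ} {s : ℝ} (hf : Ob f s) : Ob (fun x => - f x) s := by
  obtain ⟨C, hC, hf⟩ := hf
  exact ⟨C, hC, fun x hx => by rw [abs_neg]; exact hf x hx⟩

lemma Ob.sub {f g : ℝ → ℝ} {s : ℝ} (hf : Ob f s) (hg : Ob g s) : Ob (fun x => f x - g x) s := by
  simpa only [sub_eq_add_neg] using hf.add hg.neg

lemma Ob.mul {f g : ℝ → ℝ} {s t : ℝ} (hf : Ob f s) (hg : Ob g t) :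
    Ob (fun x => f x * g x) (s + t) := by
  obtain ⟨C, hC, hf⟩ := hf
  obtain ⟨D, hD, hg⟩ := hg
  refine ⟨C * D, by positivity, fun x hx => ?_⟩
  have hx0 : 0 < x := by linarith
  rw [abs_mul, Real.rpow_add hx0]
  calc |f x| * |g x| ≤ (C * x ^ s) * (D * x ^ t) :=
        mul_le_mul (hf x hx) (hg x hx) (abs_nonneg _) (by positivity)
    _ = _ := by ring

lemma Ob.mulb {f g : ℝ → ℝ} {s : ℝ} (hf : Ob f s) (hg : Ob g 0) :
    Ob (fun x => f x * g x) s := by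
  simpa using hf.mul hg

lemma Ob.const (c : ℝ) : Ob (fun _ => c) 0 := ⟨|c|, abs_nonneg _, fun x _ => by simp⟩

lemma Ob.cmul {f : ℝ → ℝ} {s : ℝ} (c : ℝ) (hf : Ob f s) : Ob (fun x => c * f x) s := by
  simpa using (Ob.const c).mul hf

lemma Ob.sin (f : ℝ → ℝ) : Ob (fun x => Real.sin (f x)) 0 :=
  ⟨1, zero_le_one, fun x _ => by simpa using Real.abs_sin_le_one (f x)⟩

lemma Ob.cos (f : ℝ → ℝ) : Ob (fun x => Real.cos (f x)) 0 :=
  ⟨1, zero_le_one, fun x _ => by simpa using Real.abs_cos_le_one (f x)⟩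

lemma Ob.rpow (s : ℝ) : Ob (fun x => x ^ s) s :=
  ⟨1, zero_le_one, fun x hx => by
    have hx0 : 0 < x := by linarith
    rw [abs_of_pos (Real.rpow_pos_of_pos hx0 s), one_mul]⟩

lemma Ob.w : Ob (fun x => (1 + x)⁻¹) (-1) :=
  ⟨1, zero_le_one, fun x hx => by
    have hx0 : 0 < x := by linarith
    rw [abs_of_pos (by positivity), one_mul, Real.rpow_neg_one]
    exact inv_anti₀ hx0 (by linarith)⟩

lemma Ob.congr {f g : ℝ → ℝ} {s : ℝ} (hf : Ob f s) (h : ∀ x, 1 < x → g x = f x) : Ob g s := by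
  obtain ⟨C, hC, hf⟩ := hf
  exact ⟨C, hC, fun x hx => by rw [h x hx]; exact hf x hx⟩

lemma Ob.final {f G r : ℝ → ℝ} (hf : ContinuousOn f (Set.Ioi 1))
    (hG : ∀ x, 1 < x → HasDerivAt G (f x - r x) x)
    (hr : Ob r (-4/3)) (hGb : Ob G (-1/3)) :
    ∃ C : ℝ, 0 < C ∧ ∀ ξ₀ ξ : ℝ, 1 < ξ₀ → ξ₀ < ξ →
      |∫ x in ξ₀..ξ, f x| ≤ C * ξ₀ ^ (-(1 : ℝ) / 3) := by
  obtain ⟨A, hA, hr⟩ := hr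
  obtain ⟨B, hB, hGb⟩ := hGb
  refine ⟨3 * A + 2 * B + 1, by positivity, fun a b ha hab => ?_⟩
  have hsub : Set.Icc a b ⊆ Set.Ioi (1:ℝ) := fun x hx => lt_of_lt_of_le ha hx.1
  have hu : Set.uIcc a b = Set.Icc a b := Set.uIcc_of_le hab.le
  have hFd : ∀ x ∈ Set.Icc a b, HasDerivAt (fun y => ∫ t in a..y, f t) (f x) x := by
    intro x hx
    have hx1 : 1 < x := hsub hx
    apply intervalIntegral.integral_hasDerivAt_right
    · apply ContinuousOn.intervalIntegrable
      rw [Set.uIcc_of_le hx.1]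
      exact hf.mono (fun y hy => lt_of_lt_of_le ha hy.1)
    · exact hf.stronglyMeasurableAtFilter isOpen_Ioi x hx1
    · exact hf.continuousAt (isOpen_Ioi.mem_nhds hx1)
  have hBd : ∀ x ∈ Set.Icc a b, HasDerivAt (fun y : ℝ => 3 * A * (a ^ (-1/3 : ℝ) - y ^ (-1/3 : ℝ)))
      (A * x ^ (-4/3 : ℝ)) x := by
    intro x hx
    have hx1 : 1 < x := hsub hx
    have h := (Real.hasDerivAt_rpow_const (x := x) (p := (-1/3 : ℝ)) (Or.inl (by linarith)))
    have h2 := (h.const_sub (a ^ (-1/3 : ℝ))).const_mul (3 * A)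
    refine HasDerivAt.congr_deriv (h2) ?_
    rw [show (-1/3 : ℝ) - 1 = -4/3 by norm_num]; ring
  have key : ∀ ⦃x⦄, x ∈ Set.Icc a b → ‖(∫ t in a..x, f t) - (G x - G a)‖ ≤
      3 * A * (a ^ (-1/3 : ℝ) - x ^ (-1/3 : ℝ)) := by
    have hd : ∀ x ∈ Set.Icc a b, HasDerivAt (fun x => (∫ t in a..x, f t) - (G x - G a)) (r x) x := by
      intro x hx
      refine HasDerivAt.congr_deriv ((hFd x hx).sub ((hG x (hsub hx)).sub_const (G a))) ?_
      ring
    refine image_norm_le_of_norm_deriv_right_le_deriv_boundary' (f' := r)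
      (B' := fun x => A * x ^ (-4/3 : ℝ)) ?_ ?_ ?_ ?_ ?_ ?_
    · exact fun x hx => (hd x hx).continuousAt.continuousWithinAt
    · exact fun x hx => (hd x ⟨hx.1, hx.2.le⟩).hasDerivWithinAt
    · simp
    · exact fun x hx => (hBd x hx).continuousAt.continuousWithinAt
    · exact fun x hx => (hBd x ⟨hx.1, hx.2.le⟩).hasDerivWithinAt
    · exact fun x hx => hr x (hsub ⟨hx.1, hx.2.le⟩)
  have hk := key (Set.right_mem_Icc.2 hab.le)
  rw [Real.norm_eq_abs] at hk
  have h1 := hGb a ha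
  have h2 := hGb b (ha.trans hab)
  have h3 : b ^ (-1/3 : ℝ) ≤ a ^ (-1/3 : ℝ) :=
    Real.rpow_le_rpow_of_nonpos (by linarith) hab.le (by norm_num)
  have h4 : 0 ≤ b ^ (-1/3 : ℝ) := Real.rpow_nonneg (by linarith) _
  have h5 : B * b ^ (-1/3 : ℝ) ≤ B * a ^ (-1/3 : ℝ) := mul_le_mul_of_nonneg_left h3 hB
  have h6 : 0 ≤ A * b ^ (-1/3 : ℝ) := mul_nonneg hA h4
  rw [abs_le] at *
  constructor <;> nlinarith

/-- Let `V` be continuous on `(0,∞)` with `|V(ξ)| ≤ K/(1+ξ)`, `E₁ ≠ E₂`,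
and for `i = 1,2` let `θᵢ` solve the Prüfer angle equation
`θᵢ'(ξ) = 1 - Q(ξ,Eᵢ)·sin²(θᵢ(ξ))` on `(1,∞)`. Then there is `C > 0` such that
`|∫_{ξ₀}^{ξ} sin(2θ₁(x))·sin(2θ₂(x))/(1+x) dx| ≤ C·ξ₀^{-1/3}` for all `ξ > ξ₀ > 1`. -/
theorem prufer_almost_orthogonality
    (V : ℝ → ℝ) (hV : ContinuousOn V (Set.Ioi 0))
    (K : ℝ) (hK : 0 ≤ K) (hVbd : ∀ ξ : ℝ, 0 < ξ → |V ξ| ≤ K / (1 + ξ))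
    (E₁ E₂ : ℝ) (hE : E₁ ≠ E₂)
    (θ₁ θ₂ : ℝ → ℝ)
    (hθ₁ : ∀ ξ : ℝ, 1 < ξ →
      HasDerivAt θ₁ (1 - Qpot V E₁ ξ * Real.sin (θ₁ ξ) ^ 2) ξ)
    (hθ₂ : ∀ ξ : ℝ, 1 < ξ →
      HasDerivAt θ₂ (1 - Qpot V E₂ ξ * Real.sin (θ₂ ξ) ^ 2) ξ) :
    ∃ C : ℝ, 0 < C ∧ ∀ ξ₀ ξ : ℝ, 1 < ξ₀ → ξ₀ < ξ →
      |∫ x in ξ₀..ξ, Real.sin (2 * θ₁ x) * Real.sin (2 * θ₂ x) / (1 + x)|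
        ≤ C * ξ₀ ^ (-(1 : ℝ) / 3) := by
  set c : ℝ := ((3 : ℝ) / 2) ^ ((2 : ℝ) / 3) with hc
  have hc0 : 0 < c := by positivity
  obtain ⟨D, hD⟩ : ∃ D, D = E₁ - E₂ := ⟨_, rfl⟩
  have hD0 : D ≠ 0 := by rw [hD]; exact sub_ne_zero.2 hE
  obtain ⟨W, hW⟩ : ∃ W : ℝ → ℝ, W = fun x => -5 / (36 * x ^ 2) + V x := ⟨_, rfl⟩
  have hWb : Ob W (-1) := by
    refine ⟨1 + K, by positivity, fun x hx => ?_⟩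
    have hx0 : 0 < x := by linarith
    rw [hW, Real.rpow_neg_one]
    refine (abs_add_le _ _).trans ?_
    have h1 : |-5 / (36 * x ^ 2)| ≤ x⁻¹ := by
      rw [abs_div, abs_of_pos (by positivity : 0 < 36 * x ^ 2), div_le_iff₀ (by positivity)]
      have : x⁻¹ * (36 * x ^ 2) = 36 * x := by field_simp
      rw [this]; norm_num; linarith
    have h2 : |V x| ≤ K * x⁻¹ := by
      refine (hVbd x hx0).trans ?_
      rw [div_eq_mul_inv]
      exact mul_le_mul_of_nonneg_left (inv_anti₀ hx0 (by linarith)) hK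
    linarith
  have hQ : ∀ E x, Qpot V E x = W x - E / (c * x ^ ((2 : ℝ) / 3)) := by
    intro E x; rw [hW, Qpot]; ring
  have hQb : ∀ E, Ob (Qpot V E) (-2/3) := by
    intro E
    have h := (hWb.mono (by norm_num : (-1 : ℝ) ≤ -2/3)).sub ((Ob.rpow (-2/3)).cmul (E / c))
    refine h.congr fun x hx => ?_
    have hx0 : 0 < x := by linarith
    rw [hQ, show (-2/3 : ℝ) = -(2/3) by norm_num, Real.rpow_neg hx0.le]
    field_simp
  obtain ⟨p₁, hp₁⟩ : ∃ p : ℝ → ℝ, p = fun x => - (Qpot V E₁ x * (Real.sin (θ₁ x) * Real.sin (θ₁ x))) := ⟨_, rfl⟩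
  obtain ⟨p₂, hp₂⟩ : ∃ p : ℝ → ℝ, p = fun x => - (Qpot V E₂ x * (Real.sin (θ₂ x) * Real.sin (θ₂ x))) := ⟨_, rfl⟩
  have hp₁b : Ob p₁ (-2/3) := by
    rw [hp₁]; exact ((hQb E₁).mulb ((Ob.sin θ₁).mulb (Ob.sin θ₁))).neg
  have hp₂b : Ob p₂ (-2/3) := by
    rw [hp₂]; exact ((hQb E₂).mulb ((Ob.sin θ₂).mulb (Ob.sin θ₂))).neg
  have hd₁ : ∀ x, 1 < x → HasDerivAt θ₁ (1 + p₁ x) x := by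
    intro x hx
    refine HasDerivAt.congr_deriv (hθ₁ x hx) ?_
    rw [hp₁]; ring
  have hd₂ : ∀ x, 1 < x → HasDerivAt θ₂ (1 + p₂ x) x := by
    intro x hx
    refine HasDerivAt.congr_deriv (hθ₂ x hx) ?_
    rw [hp₂]; ring
  -- building blocks
  obtain ⟨N, hN⟩ : ∃ N : ℝ → ℝ, N = fun x =>
    E₁ * Real.sin (2 * θ₁ x) - E₂ * Real.sin (2 * θ₂ x) := ⟨_, rfl⟩
  have hNb : Ob N 0 := by
    rw [hN]; exact ((Ob.sin _).cmul _).sub ((Ob.sin _).cmul _)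
  obtain ⟨g, hg⟩ : ∃ g : ℝ → ℝ, g = fun x => c / D * (x ^ ((2 : ℝ) / 3) * (1 + x)⁻¹) := ⟨_, rfl⟩
  have hgb : Ob g (-1/3) := by
    rw [hg]
    exact (((Ob.rpow _).mul Ob.w).cmul _).mono (by norm_num)
  obtain ⟨w', hw'⟩ : ∃ w' : ℝ → ℝ, w' = fun x => - ((1 + x)⁻¹ * (1 + x)⁻¹) := ⟨_, rfl⟩
  have hw'b : Ob w' (-2) := by
    rw [hw']; exact (Ob.w.mul Ob.w).neg.mono (by norm_num)
  have hwd : ∀ x, 1 < x → HasDerivAt (fun x : ℝ => (1 + x)⁻¹) (w' x) x := by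
    intro x hx
    have hx0 : 1 + x ≠ 0 := by linarith
    refine HasDerivAt.congr_deriv (((hasDerivAt_id x).const_add 1).inv hx0) ?_
    rw [hw']; simp only [id]; field_simp
  obtain ⟨g', hg'⟩ : ∃ g' : ℝ → ℝ, g' = fun x => c / D * ((2/3 : ℝ) * x ^ ((2/3 : ℝ) - 1) * (1 + x)⁻¹
    + x ^ ((2 : ℝ) / 3) * w' x) := ⟨_, rfl⟩
  have hg'b : Ob g' (-4/3) := by
    rw [hg']
    exact Ob.cmul _ (((((Ob.rpow _).cmul _).mul Ob.w).mono (by norm_num)).add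
      (((Ob.rpow _).mul hw'b).mono (by norm_num)))
  have hgd : ∀ x, 1 < x → HasDerivAt g (g' x) x := by
    intro x hx
    rw [hg, hg']
    exact ((Real.hasDerivAt_rpow_const (Or.inl (by linarith))).mul (hwd x hx)).const_mul _
  obtain ⟨ψ, hψ⟩ : ∃ ψ : ℝ → ℝ, ψ = fun x => 2 * (θ₁ x - θ₂ x) := ⟨_, rfl⟩
  obtain ⟨φ, hφ⟩ : ∃ φ : ℝ → ℝ, φ = fun x => 2 * (θ₁ x + θ₂ x) := ⟨_, rfl⟩
  have hψd : ∀ x, 1 < x → HasDerivAt ψ (2 * (p₁ x - p₂ x)) x := by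
    intro x hx
    rw [hψ]
    refine HasDerivAt.congr_deriv (((hd₁ x hx).sub (hd₂ x hx)).const_mul 2) ?_
    ring
  have hφd : ∀ x, 1 < x → HasDerivAt φ (4 + 2 * (p₁ x + p₂ x)) x := by
    intro x hx
    rw [hφ]
    refine HasDerivAt.congr_deriv (((hd₁ x hx).add (hd₂ x hx)).const_mul 2) ?_
    ring
  obtain ⟨N', hN'⟩ : ∃ N' : ℝ → ℝ, N' = fun x =>
    2 * (E₁ * (Real.cos (2 * θ₁ x) * (1 + p₁ x)) - E₂ * (Real.cos (2 * θ₂ x) * (1 + p₂ x))) := ⟨_, rfl⟩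
  have hNd : ∀ x, 1 < x → HasDerivAt N (N' x) x := by
    intro x hx
    rw [hN, hN']
    refine HasDerivAt.congr_deriv (((((hd₁ x hx).const_mul 2).sin).const_mul E₁).sub
      ((((hd₂ x hx).const_mul 2).sin).const_mul E₂)) ?_
    ring
  obtain ⟨G, hG⟩ : ∃ G : ℝ → ℝ, G = fun x =>
    1/2 * (g x * Real.sin (ψ x)) + 1/(4*D) * ((1 + x)⁻¹ * Real.cos (ψ x) * N x)
      - 1/8 * ((1 + x)⁻¹ * Real.sin (φ x)) := ⟨_, rfl⟩
  have hGb : Ob G (-1/3) := by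
    rw [hG]
    refine Ob.sub (Ob.add ((hgb.mulb (Ob.sin _)).cmul _) ?_) ?_
    · exact (((Ob.w.mulb (Ob.cos _)).mulb hNb).cmul _).mono (by norm_num)
    · exact ((Ob.w.mulb (Ob.sin _)).cmul _).mono (by norm_num)
  have hGd : ∀ x, 1 < x → HasDerivAt G
      (1/2 * (g' x * Real.sin (ψ x) + g x * (Real.cos (ψ x) * (2 * (p₁ x - p₂ x))))
      + 1/(4*D) * ((w' x * Real.cos (ψ x) + (1 + x)⁻¹ * (-Real.sin (ψ x) * (2 * (p₁ x - p₂ x)))) * N x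
        + (1 + x)⁻¹ * Real.cos (ψ x) * N' x)
      - 1/8 * (w' x * Real.sin (φ x) + (1 + x)⁻¹ * (Real.cos (φ x) * (4 + 2 * (p₁ x + p₂ x))))) x := by
    intro x hx
    rw [hG]
    exact ((((hgd x hx).mul (hψd x hx).sin).const_mul _).add
      ((((hwd x hx).mul (hψd x hx).cos).mul (hNd x hx)).const_mul _)).sub
      (((hwd x hx).mul (hφd x hx).sin).const_mul _)
  obtain ⟨r, hr⟩ : ∃ r : ℝ → ℝ, r = fun x =>
    -(1/2) * (g' x * Real.sin (ψ x)) - 1/(4*D) * (w' x * Real.cos (ψ x) * N x)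
    + 1/(2*D) * ((1 + x)⁻¹ * (p₁ x - p₂ x) * Real.sin (ψ x) * N x)
    - 1/(2*D) * ((1 + x)⁻¹ * (E₁ * (p₁ x * Real.cos (2 * θ₁ x)) - E₂ * (p₂ x * Real.cos (2 * θ₂ x)))
        * Real.cos (ψ x))
    + 1/8 * (w' x * Real.sin (φ x)) + 1/4 * ((1 + x)⁻¹ * (p₁ x + p₂ x) * Real.cos (φ x))
    + g x * W x * (Real.sin (θ₁ x) * Real.sin (θ₁ x) - Real.sin (θ₂ x) * Real.sin (θ₂ x))
        * Real.cos (ψ x) := ⟨_, rfl⟩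
  have hrb : Ob r (-4/3) := by
    rw [hr]
    refine Ob.add (Ob.add (Ob.add (Ob.sub (Ob.add (Ob.sub ?_ ?_) ?_) ?_) ?_) ?_) ?_
    · exact (hg'b.mulb (Ob.sin _)).cmul _
    · exact (((hw'b.mulb (Ob.cos _)).mulb hNb).cmul _).mono (by norm_num)
    · exact ((((Ob.w.mul (hp₁b.sub hp₂b)).mulb (Ob.sin _)).mulb hNb).cmul _).mono (by norm_num)
    · exact (((Ob.w.mul (((hp₁b.mulb (Ob.cos _)).cmul _).sub
        ((hp₂b.mulb (Ob.cos _)).cmul _))).mulb (Ob.cos _)).cmul _).mono (by norm_num)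
    · exact ((hw'b.mulb (Ob.sin _)).cmul _).mono (by norm_num)
    · exact (((Ob.w.mul (hp₁b.add hp₂b)).mulb (Ob.cos _)).cmul _).mono (by norm_num)
    · exact (((hgb.mul hWb).mulb (((Ob.sin _).mulb (Ob.sin _)).sub
        ((Ob.sin _).mulb (Ob.sin _)))).mulb (Ob.cos _)).mono (by norm_num)
  have hcont : ContinuousOn (fun x => Real.sin (2 * θ₁ x) * Real.sin (2 * θ₂ x) / (1 + x))
      (Set.Ioi 1) := by
    intro x hx
    have hx1 : (1:ℝ) < x := hx
    have c1 := (hd₁ x hx).continuousAt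
    have c2 := (hd₂ x hx).continuousAt
    have hx0 : 1 + x ≠ 0 := by linarith
    apply ContinuousAt.continuousWithinAt
    fun_prop (disch := assumption)
  refine Ob.final hcont (G := G) (r := r) (fun x hx => ?_) hrb hGb
  refine HasDerivAt.congr_deriv (hGd x hx) ?_
  have hx0 : 0 < x := by linarith
  have hX : 0 < x ^ ((2 : ℝ) / 3) := by positivity
  -- key identity for the slowly varying phase
  have e1 : Real.sin (θ₁ x) * Real.sin (θ₁ x) = (1 - Real.cos (2 * θ₁ x)) / 2 := by
    rw [Real.cos_two_mul]; nlinarith [Real.sin_sq_add_cos_sq (θ₁ x)]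
  have e2 : Real.sin (θ₂ x) * Real.sin (θ₂ x) = (1 - Real.cos (2 * θ₂ x)) / 2 := by
    rw [Real.cos_two_mul]; nlinarith [Real.sin_sq_add_cos_sq (θ₂ x)]
  have key : g x * (2 * (p₁ x - p₂ x)) = (1 + x)⁻¹
      - (1 + x)⁻¹ / D * (E₁ * Real.cos (2 * θ₁ x) - E₂ * Real.cos (2 * θ₂ x))
      - 2 * (g x * W x * (Real.sin (θ₁ x) * Real.sin (θ₁ x) - Real.sin (θ₂ x) * Real.sin (θ₂ x))) := by
    have hgX : g x / (c * x ^ ((2 : ℝ) / 3)) = (1 + x)⁻¹ / D := by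
      rw [hg]; field_simp
    have : g x * (2 * (p₁ x - p₂ x)) =
        2 * (g x / (c * x ^ ((2 : ℝ) / 3))) * (E₁ * (Real.sin (θ₁ x) * Real.sin (θ₁ x))
          - E₂ * (Real.sin (θ₂ x) * Real.sin (θ₂ x)))
        - 2 * (g x * W x * (Real.sin (θ₁ x) * Real.sin (θ₁ x) - Real.sin (θ₂ x) * Real.sin (θ₂ x))) := by
      rw [hp₁, hp₂]; simp only [hQ]; ring
    rw [this, hgX, e1, e2]
    have : (1 + x)⁻¹ = (1 + x)⁻¹ / D * (E₁ - E₂) := by rw [← hD]; field_simp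
    linear_combination -this
  have hf : Real.sin (2 * θ₁ x) * Real.sin (2 * θ₂ x) / (1 + x)
      = 1/2 * (Real.cos (ψ x) - Real.cos (φ x)) * (1 + x)⁻¹ := by
    rw [hψ, hφ]; simp only [mul_add, mul_sub, Real.cos_add, Real.cos_sub]; ring
  rw [hf, hr, hN']
  simp only []
  linear_combination (1/2 * Real.cos (ψ x)) * key
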